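/- Let L be a vector space over a field k of characteristic not 2 or 3 with a bilinear bracket ⟨ , ⟩ satisfying the right Leibniz identity ⟨⟨x, y⟩, z⟩ = ⟨x, ⟨y, z⟩⟩ + ⟨⟨x, z⟩, y⟩ for all x, y, z ∈ L. Then L is a generalized Malcev algebra; that is, the bracket is right anti-commutative and satisfies the three Hu-Liu angle identities: (i) ⟨⟨x,y⟩,⟨x,z⟩⟩ − ⟨⟨x,z⟩,⟨x,y⟩⟩ = ⟨⟨⟨x,y⟩,z⟩,x⟩ − ⟨x,⟨⟨x,y⟩,z⟩⟩ + ⟨x,⟨x,⟨y,z⟩⟩⟩ − ⟨⟨x,⟨y,z⟩⟩,x⟩ + ⟨⟨x,⟨x,z⟩⟩,y⟩ − ⟨⟨⟨x,z⟩,x⟩,y⟩; (ii) ⟨⟨y,x⟩,⟨x,z⟩⟩ = ⟨⟨⟨y,x⟩,z⟩,x⟩ − ⟨y,⟨⟨x,z⟩,x⟩⟩ − ⟨⟨⟨y,z⟩,x⟩,x⟩; (iii) ⟨⟨z,x⟩,⟨y,x⟩⟩ = ⟨⟨z,⟨x,y⟩⟩,x⟩ + ⟨⟨⟨z,y⟩,x⟩,x⟩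 − ⟨⟨⟨z,x⟩,x⟩,y⟩, for all x, y, z ∈ L. -/

import Mathlib

/-- A right Leibniz algebra over a field of characteristic not `2` or `3` is a
generalized Malcev algebra: the bracket is right anti-commutative and satisfies
the three Hu-Liu angle identities. -/
theorem rightLeibniz_is_generalized_Malcev
    (k : Type*) [Field k] (h2 : (2 : k) ≠ 0) (h3 : (3 : k) ≠ 0)
    (L : Type*) [AddCommGroup L] [Module k L]
    (br : L →ₗ[k] L →ₗ[k] L)
    (leib : ∀ x y z : L, br (br x y) z = br x (br y z) + br (br x z) y) :
    -- right anti-commutativity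
    (∀ x y z : L, br x (br y z) = - br x (br z y)) ∧
    -- Hu-Liu angle identity (i)
    (∀ x y z : L,
      br (br x y) (br x z) - br (br x z) (br x y)
        = br (br (br x y) z) x - br x (br (br x y) z)
          + br x (br x (br y z)) - br (br x (br y z)) x
          + br (br x (br x z)) y - br (br (br x z) x) y) ∧
    -- Hu-Liu angle identity (ii)
    (∀ x y z : L,
      br (br y x) (br x z)
        = br (br (br y x) z) x - br y (br (br x z) x) - br (br (br y z) x) x) ∧
    -- Hu-Liu angle identity (iii)
    (∀ x y z : L,
      br (br z x) (br y x)
        = br (br z (br x y)) x + br (br (br z y) x) x - br (br (br z x) x) y) := by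
  have expand (a b c : L) : br a (br b c) = br (br a b) c - br (br a c) b :=
    eq_sub_of_add_eq (leib a b c).symm
  refine ⟨fun x y z => ?_, fun x y z => ?_, fun x y z => ?_, fun x y z => ?_⟩ <;>
  · simp only [expand, map_sub, LinearMap.sub_apply]
    abel
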